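/- Let C̄(x), D̄(x) ∈ (ℤ/4ℤ)[[x]] be the reductions modulo 4 of C(x) and D(x). There is no polynomial R(x,y) = Σ_{i=0}^{n} q_i(x)·y^i in (ℤ/4ℤ)[x][y] with n ≤ 3, q_n ≠ 0, whose leading coefficient q_n(x) becomes a unit in the ring of formal Laurent series (ℤ/4ℤ)((x)), such that R(x, C̄(x)) = 0 or R(x, D̄(x)) = 0 in (ℤ/4ℤ)[[x]]. -/

import Mathlib

open Polynomial

/-- The Thue–Morse ±1 sequence: t 0 = 1, t (2n) = t n, t (2n+1) = -t n. -/
def tmSeq : ℕ → ℤ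
  | 0 => 1
  | n + 1 => if (n + 1) % 2 = 0 then tmSeq ((n + 1) / 2) else -tmSeq ((n + 1) / 2)
decreasing_by all_goals exact Nat.div_lt_self (Nat.succ_pos n) one_lt_two

/-- Numerators of the convergents of the Thue–Morse continued fraction. -/
noncomputable def Ptm : ℕ → ℤ[X]
  | 0 => 1
  | 1 => 1
  | n + 2 => Ptm (n + 1) + C (tmSeq (n + 2)) * X * Ptm n

/-- Denominators of the convergents of the Thue–Morse continued fraction. -/
noncomputable def Qtm : ℕ → ℤ[X]
  | 0 => 1
  | 1 => 1 - X
  | n + 2 => Qtm (n + 1) + C (tmSeq (n + 2)) * X * Qtm n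

open Polynomial

/-- The period-doubling ±1 sequence: s (2n) = 1, s (2n+1) = -s n. -/
def pdSeq : ℕ → ℤ
  | 0 => 1
  | n + 1 => if (n + 1) % 2 = 0 then 1 else -pdSeq ((n + 1) / 2)
decreasing_by exact Nat.div_lt_self (Nat.succ_pos n) one_lt_two

/-- Numerators of the convergents of the period-doubling continued fraction. -/
noncomputable def Ppd : ℕ → ℤ[X]
  | 0 => 1
  | 1 => 1
  | n + 2 => Ppd (n + 1) + C (pdSeq (n + 2)) * X * Ppd n

/-- Denominators of the convergents of the period-doubling continued fraction. -/
noncomputable def Qpd : ℕ → ℤ[X]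
  | 0 => 1
  | 1 => 1 - X
  | n + 2 => Qpd (n + 1) + C (pdSeq (n + 2)) * X * Qpd n

/-- A quadratic relation `e p² + f p q + g q² = 0` over `𝔽₂[X]` with `e`, `f`, `g` of degree one
has only the trivial solution, because `u² + u v + v²` is anisotropic over `𝔽₂`. -/
lemma eq_zero_of_quadratic_relation {e f g p q : (ZMod 2)[X]} (he : e.natDegree = 1)
    (hf : f.natDegree = 1) (hg : g.natDegree = 1)
    (h : e * p ^ 2 + f * (p * q) + g * q ^ 2 = 0) : q = 0 := by
  set m := max p.natDegree q.natDegree with hm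
  have hp : p.natDegree ≤ m := le_max_left _ _
  have hq : q.natDegree ≤ m := le_max_right _ _
  have lead : ∀ r : (ZMod 2)[X], r.natDegree = 1 → r.coeff 1 = 1 := by
    intro r hr
    have h0 : r.leadingCoeff ≠ 0 := by
      rw [Ne, leadingCoeff_eq_zero]; rintro rfl; simp at hr
    rw [leadingCoeff, hr] at h0
    exact (by decide : ∀ x : ZMod 2, x ≠ 0 → x = 1) _ h0
  have hc := congrArg (fun r => coeff r (1 + 2 * m)) h
  have hpq : (p * q).coeff (2 * m) = p.coeff m * q.coeff m := by
    rw [two_mul]; exact coeff_mul_add_eq_of_natDegree_le hp hq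
  have hpq' : (p * q).natDegree ≤ 2 * m := by
    rw [two_mul]; exact natDegree_mul_le_of_le hp hq
  simp only [coeff_add, coeff_zero] at hc
  rw [coeff_mul_add_eq_of_natDegree_le he.le (natDegree_pow_le_of_le 2 hp),
    coeff_mul_add_eq_of_natDegree_le hf.le hpq',
    coeff_mul_add_eq_of_natDegree_le hg.le (natDegree_pow_le_of_le 2 hq),
    coeff_pow_of_natDegree_le hp, coeff_pow_of_natDegree_le hq, hpq,
    lead e he, lead f hf, lead g hg] at hc
  obtain ⟨hp0, hq0⟩ := (by decide : ∀ x y : ZMod 2,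
    1 * x ^ 2 + 1 * (x * y) + 1 * y ^ 2 = 0 → x = 0 ∧ y = 0) _ _ hc
  by_contra hne
  rcases max_choice p.natDegree q.natDegree with h1 | h1
  · have : p = 0 := by
      rw [← leadingCoeff_eq_zero, leadingCoeff, ← h1]; exact hp0
    subst this
    have : g ≠ 0 := by rintro rfl; simp at hg
    simp_all
  · exact hne (by rw [← leadingCoeff_eq_zero, leadingCoeff, ← h1]; exact hq0)

lemma eq_zero_of_X_mul_sq_add {p q : (ZMod 2)[X]} (h : X * q ^ 2 + p * q + p ^ 2 = 0) :
    p = 0 ∧ q = 0 := by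
  rcases le_or_gt p.natDegree q.natDegree with hle | hlt
  · have hc := congrArg (fun r => coeff r (2 * q.natDegree + 1)) h
    have h1 : (p * q).coeff (2 * q.natDegree + 1) = 0 :=
      coeff_eq_zero_of_natDegree_lt (lt_of_le_of_lt natDegree_mul_le (by omega))
    have h2 : (p ^ 2).coeff (2 * q.natDegree + 1) = 0 :=
      coeff_eq_zero_of_natDegree_lt (lt_of_le_of_lt natDegree_pow_le (by omega))
    simp only [coeff_add, coeff_X_mul, h1, h2, coeff_zero, add_zero,
      coeff_pow_of_natDegree_le le_rfl] at hc
    have hq : q = 0 := by simpa using hc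
    subst hq
    exact ⟨by simpa using h, rfl⟩
  · exfalso
    have hc := congrArg (fun r => coeff r (2 * p.natDegree)) h
    have h1 : (p * q).coeff (2 * p.natDegree) = 0 :=
      coeff_eq_zero_of_natDegree_lt (lt_of_le_of_lt natDegree_mul_le (by omega))
    have h2 : (X * q ^ 2).coeff (2 * p.natDegree) = 0 := by
      refine coeff_eq_zero_of_natDegree_lt (lt_of_le_of_lt natDegree_mul_le ?_)
      have := natDegree_pow_le (p := q) (n := 2)
      have := natDegree_X_le (R := ZMod 2)
      omega
    simp only [coeff_add, h1, h2, coeff_zero, zero_add,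
      coeff_pow_of_natDegree_le le_rfl] at hc
    have hp : p = 0 := by simpa using hc
    simp [hp] at hlt

/-- Evaluation at a nonzero power series without constant term is injective on polynomials. -/
lemma eq_zero_of_aeval_eq_zero {K : Type*} [Field K] {ξ : PowerSeries K}
    (hξ : ξ ≠ 0) (h0 : PowerSeries.constantCoeff ξ = 0) (p : K[X]) (hp : aeval ξ p = 0) :
    p = 0 := by
  induction hn : p.natDegree using Nat.strong_induction_on generalizing p with
  | _ n ih =>
    have hsplit := divX_mul_X_add p
    have hcoeff : p.coeff 0 = 0 := by
      have := hp
      rw [← hsplit] at this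
      simpa [h0, ← PowerSeries.algebraMap_apply'] using congrArg PowerSeries.constantCoeff this
    rw [hcoeff, C_0, add_zero] at hsplit
    have hdiv : aeval ξ p.divX = 0 := by
      rw [← hsplit, map_mul, aeval_X] at hp
      exact (mul_eq_zero.mp hp).resolve_right hξ
    by_cases hdeg : n = 0
    · rw [eq_C_of_natDegree_eq_zero (hn.trans hdeg), hcoeff, C_0]
    · have := ih p.divX.natDegree (by rw [natDegree_divX_eq_natDegree_tsub_one]; omega) _ hdiv rfl
      rw [← hsplit, this, zero_mul]

lemma two_eq_zero_of_zmod_two : (2 : PowerSeries (ZMod 2)) = 0 := by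
  rw [← map_ofNat PowerSeries.C 2, show (OfNat.ofNat 2 : ZMod 2) = 0 from rfl, map_zero]

lemma indep_of_quadratic {ξ g : PowerSeries (ZMod 2)} (hξ : ξ ≠ 0)
    (h0 : PowerSeries.constantCoeff ξ = 0) (hg : ξ * g ^ 2 = g + 1) {p q : (ZMod 2)[X]}
    (h : aeval ξ p * g + aeval ξ q = 0) : p = 0 ∧ q = 0 := by
  have two : (2 : PowerSeries (ZMod 2)) = 0 := two_eq_zero_of_zmod_two
  apply eq_zero_of_X_mul_sq_add
  apply eq_zero_of_aeval_eq_zero hξ h0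
  simp only [map_add, map_mul, map_pow, aeval_X]
  set a := aeval ξ p
  set b := aeval ξ q
  linear_combination (ξ * (b - a * g) + a) * h + a ^ 2 * hg + a ^ 2 * two

lemma cubic_double_root {ξ g : PowerSeries (ZMod 2)} (hξ : ξ ≠ 0)
    (h0 : PowerSeries.constantCoeff ξ = 0) (hg : ξ * g ^ 2 = g + 1) {q₀ q₁ q₂ q₃ : (ZMod 2)[X]}
    (h : aeval ξ q₀ + aeval ξ q₁ * g + aeval ξ q₂ * g ^ 2 + aeval ξ q₃ * g ^ 3 = 0)
    (h' : aeval ξ q₁ + 2 * aeval ξ q₂ * g + 3 * aeval ξ q₃ * g ^ 2 = 0) :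
    q₀ = 0 ∧ q₁ = 0 ∧ q₂ = 0 ∧ q₃ = 0 := by
  have two : (2 : PowerSeries (ZMod 2)) = 0 := two_eq_zero_of_zmod_two
  obtain ⟨h3, h1⟩ := indep_of_quadratic hξ h0 hg (p := q₃) (q := q₃ + X * q₁) (by
    simp only [map_add, map_mul, aeval_X]
    linear_combination ξ * h' - aeval ξ q₃ * hg
      - (ξ * g * aeval ξ q₂ + ξ * g ^ 2 * aeval ξ q₃) * two)
  subst h3
  have h1 : q₁ = 0 := by simpa using h1
  subst h1
  simp only [map_zero, zero_mul, add_zero] at h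
  obtain ⟨h2, h00⟩ := indep_of_quadratic hξ h0 hg (p := q₂) (q := q₂ + X * q₀) (by
    simp only [map_add, map_mul, aeval_X]
    linear_combination ξ * h - aeval ξ q₂ * hg)
  subst h2
  exact ⟨by simpa using h00, rfl, rfl, rfl⟩

/-- The power series that become polynomials after multiplication by a power of `1 + X`. -/
noncomputable def awayOneAddX (S : Type*) [CommRing S] : Subring (PowerSeries S) where
  carrier := {f | ∃ (N : ℕ) (r : S[X]), (1 + PowerSeries.X : PowerSeries S) ^ N * f = r}
  mul_mem' := by
    rintro f g ⟨N, r, hr⟩ ⟨M, s, hs⟩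
    exact ⟨N + M, r * s, by rw [Polynomial.coe_mul, ← hr, ← hs]; ring⟩
  one_mem' := ⟨0, 1, by simp⟩
  add_mem' := by
    rintro f g ⟨N, r, hr⟩ ⟨M, s, hs⟩
    refine ⟨N + M, (1 + X) ^ M * r + (1 + X) ^ N * s, ?_⟩
    rw [Polynomial.coe_add, Polynomial.coe_mul, Polynomial.coe_mul, ← hr, ← hs]
    simp only [Polynomial.coe_pow, Polynomial.coe_add, Polynomial.coe_one, Polynomial.coe_X]
    ring
  zero_mem' := ⟨0, 0, by simp⟩
  neg_mem' := by
    rintro f ⟨N, r, hr⟩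
    exact ⟨N, -r, by rw [Polynomial.coe_neg, ← hr]; ring⟩

lemma mem_awayOneAddX {S : Type*} [CommRing S] {f : PowerSeries S} :
    f ∈ awayOneAddX S ↔ ∃ (N : ℕ) (r : S[X]), (1 + PowerSeries.X : PowerSeries S) ^ N * f = r :=
  Iff.rfl

lemma coe_mem_awayOneAddX {S : Type*} [CommRing S] (p : S[X]) :
    (p : PowerSeries S) ∈ awayOneAddX S :=
  mem_awayOneAddX.mpr ⟨0, p, by simp⟩

lemma aeval_mem_awayOneAddX {S : Type*} [CommRing S] {ξ : PowerSeries S}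
    (hξ : ξ ∈ awayOneAddX S) (p : S[X]) : aeval ξ p ∈ awayOneAddX S := by
  rw [aeval_eq_sum_range]
  refine Subring.sum_mem _ fun i _ => ?_
  rw [PowerSeries.smul_eq_C_mul, ← Polynomial.coe_C]
  exact Subring.mul_mem _ (coe_mem_awayOneAddX _) (Subring.pow_mem _ hξ i)

/-- The reduction homomorphism `ℤ/4ℤ → ℤ/2ℤ`. -/
abbrev zmodFourTwo : ZMod 4 →+* ZMod 2 := ZMod.castHom ⟨2, rfl⟩ (ZMod 2)

/-- Reduction of power series from `ℤ/4ℤ` to `ℤ/2ℤ`. -/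
noncomputable def redFourTwo : PowerSeries (ZMod 4) →+* PowerSeries (ZMod 2) :=
  PowerSeries.map zmodFourTwo

lemma coeff_redFourTwo (f : PowerSeries (ZMod 4)) (n : ℕ) :
    PowerSeries.coeff n (redFourTwo f) =
      zmodFourTwo (PowerSeries.coeff n f) := by
  simp [redFourTwo]

lemma redFourTwo_coe (p : (ZMod 4)[X]) :
    redFourTwo p = (p.map zmodFourTwo : (ZMod 2)[X]) := by
  rw [redFourTwo, Polynomial.polynomial_map_coe]

lemma redFourTwo_eq_zero {f : PowerSeries (ZMod 4)} (hf : 2 * f = 0) : redFourTwo f = 0 := by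
  ext n
  have := congrArg (PowerSeries.coeff n) hf
  rw [← map_ofNat PowerSeries.C 2, PowerSeries.coeff_C_mul, map_zero] at this
  rw [coeff_redFourTwo, map_zero]
  exact (by decide : ∀ x : ZMod 4, 2 * x = 0 →
    zmodFourTwo x = 0) _ this

lemma exists_eq_two_mul {r : (ZMod 4)[X]} (hr : redFourTwo r = 0) :
    ∃ s : (ZMod 4)[X], r = 2 * s := by
  have : C 2 ∣ r := by
    rw [C_dvd_iff_dvd_coeff]
    intro n
    have := congrArg (PowerSeries.coeff n) hr
    rw [coeff_redFourTwo, map_zero, Polynomial.coeff_coe] at this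
    exact (by decide : ∀ x : ZMod 4,
      zmodFourTwo x = 0 → 2 ∣ x) _ this
  obtain ⟨s, hs⟩ := this
  exact ⟨s, by rw [hs, map_ofNat]⟩

lemma four_eq_zero_of_zmod_four : (4 : PowerSeries (ZMod 4)) = 0 := by
  rw [← map_ofNat PowerSeries.C 4, show (OfNat.ofNat 4 : ZMod 4) = 0 from rfl, map_zero]

lemma redFourTwo_leadingCoeff_ne_zero {p : (ZMod 4)[X]}
    (hu : IsUnit (HahnSeries.ofPowerSeries ℤ (ZMod 4) (p : PowerSeries (ZMod 4)))) :
    p.map zmodFourTwo ≠ 0 := by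
  intro h
  obtain ⟨s, rfl⟩ := exists_eq_two_mul (r := p) (by rw [redFourTwo_coe, h, Polynomial.coe_zero])
  have h2 : (2 : PowerSeries (ZMod 4)) * ((2 * s : (ZMod 4)[X]) : PowerSeries (ZMod 4)) = 0 := by
    have : ((2 : (ZMod 4)[X]) : PowerSeries (ZMod 4)) = 2 := map_ofNat coeToPowerSeries.ringHom 2
    rw [Polynomial.coe_mul, this]
    linear_combination (s : PowerSeries (ZMod 4)) * four_eq_zero_of_zmod_four
  have h3 := congrArg (HahnSeries.ofPowerSeries ℤ (ZMod 4)) h2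
  rw [map_mul, map_zero, hu.mul_left_eq_zero,
    ← map_zero (HahnSeries.ofPowerSeries ℤ (ZMod 4))] at h3
  have h4 := congrArg (PowerSeries.coeff 0) (HahnSeries.ofPowerSeries_injective h3)
  rw [← map_ofNat PowerSeries.C 2, PowerSeries.coeff_zero_C, map_zero] at h4
  exact absurd h4 (by decide)

lemma exists_mul_one_add_X_sq (S : Type*) [CommRing S] :
    ∃ ξ : PowerSeries S, ξ * (1 + PowerSeries.X) ^ 2 = -PowerSeries.X := by
  have hu : IsUnit ((1 + PowerSeries.X : PowerSeries S) ^ 2) := by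
    simp [PowerSeries.isUnit_iff_constantCoeff]
  obtain ⟨v, hv⟩ := hu.exists_left_inv
  exact ⟨-PowerSeries.X * v, by rw [mul_assoc, hv, mul_one]⟩

/-- If the reduction of `B` modulo `2` is irrational, then a cubic relation over `(ℤ/4ℤ)[ξ]`
satisfied by `(1 + X)(1 + 2B)`, where `ξ = -X/(1+X)²`, vanishes modulo `2`. -/
lemma map_eq_zero_of_cubic {ξ B : PowerSeries (ZMod 4)}
    (hξ : ξ * (1 + PowerSeries.X) ^ 2 = -PowerSeries.X) {q₀ q₁ q₂ q₃ : (ZMod 4)[X]}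
    (h : aeval ξ q₀ + aeval ξ q₁ * ((1 + PowerSeries.X) * (1 + 2 * B)) +
      aeval ξ q₂ * ((1 + PowerSeries.X) * (1 + 2 * B)) ^ 2 +
      aeval ξ q₃ * ((1 + PowerSeries.X) * (1 + 2 * B)) ^ 3 = 0)
    (hB : ∀ p q : (ZMod 2)[X], (q : PowerSeries (ZMod 2)) * redFourTwo B = p → q = 0) :
    q₀.map zmodFourTwo = 0 ∧
    q₁.map zmodFourTwo = 0 ∧
    q₂.map zmodFourTwo = 0 ∧
    q₃.map zmodFourTwo = 0 := by
  have four := four_eq_zero_of_zmod_four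
  have red_aeval (q : (ZMod 4)[X]) : redFourTwo (aeval ξ q) =
      aeval (redFourTwo ξ) (q.map zmodFourTwo) := by
    rw [aeval_def, hom_eval₂, aeval_def, eval₂_map]
    congr 1
    ext x
    simp [redFourTwo]
  have red_X : redFourTwo PowerSeries.X = PowerSeries.X := by simp [redFourTwo]
  set g : PowerSeries (ZMod 4) := 1 + PowerSeries.X with hg
  have red_g : redFourTwo g = 1 + PowerSeries.X := by rw [hg, map_add, map_one, red_X]
  set U := aeval ξ q₀ + aeval ξ q₁ * g + aeval ξ q₂ * g ^ 2 + aeval ξ q₃ * g ^ 3 with hU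
  set V := aeval ξ q₁ + 2 * aeval ξ q₂ * g + 3 * aeval ξ q₃ * g ^ 2 with hV
  have hUV : U + 2 * (g * B * V) = 0 := by
    rw [hU, hV]
    linear_combination h - (aeval ξ q₂ * g ^ 2 * B ^ 2 +
      aeval ξ q₃ * g ^ 3 * (3 * B ^ 2 + 2 * B ^ 3)) * four
  have hg_mem : g ∈ awayOneAddX (ZMod 4) := by
    exact add_mem (one_mem _) (by simpa using coe_mem_awayOneAddX (X : (ZMod 4)[X]))
  have hξ_mem : ξ ∈ awayOneAddX (ZMod 4) :=
    mem_awayOneAddX.mpr ⟨2, -X, by rw [← hg, mul_comm, hξ]; simp⟩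
  have mem := aeval_mem_awayOneAddX hξ_mem
  have hUmem : U ∈ awayOneAddX (ZMod 4) := by
    refine add_mem (add_mem (add_mem (mem _) (mul_mem (mem _) hg_mem)) ?_) ?_ <;>
    exact mul_mem (mem _) (pow_mem hg_mem _)
  have hVmem : V ∈ awayOneAddX (ZMod 4) :=
    add_mem (add_mem (mem _) (mul_mem (mul_mem (ofNat_mem _ 2) (mem _)) hg_mem))
      (mul_mem (mul_mem (ofNat_mem _ 3) (mem _)) (pow_mem hg_mem _))
  have hU0 : redFourTwo U = 0 := by
    refine redFourTwo_eq_zero ?_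
    linear_combination 2 * hUV - g * B * V * four
  have hV0 : redFourTwo V = 0 := by
    obtain ⟨N, r, hr⟩ := mem_awayOneAddX.mp hUmem
    obtain ⟨M, v, hv⟩ := mem_awayOneAddX.mp hVmem
    rw [← hg] at hr hv
    obtain ⟨s, rfl⟩ := exists_eq_two_mul (r := r) (by rw [← hr, map_mul, hU0, mul_zero])
    have htwo : ((2 : (ZMod 4)[X]) : PowerSeries (ZMod 4)) = 2 :=
      map_ofNat coeToPowerSeries.ringHom 2
    rw [Polynomial.coe_mul, htwo] at hr
    have hrel := redFourTwo_eq_zero (f := g ^ M * s + g ^ N * g * B * v) (by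
      linear_combination g ^ (M + N) * hUV - g ^ M * hr - 2 * g ^ N * g * B * hv)
    simp only [map_add, map_mul, map_pow, red_g, redFourTwo_coe] at hrel
    have hzero := hB (-((1 + X) ^ M * s.map zmodFourTwo))
      ((1 + X) ^ N * (1 + X) * v.map zmodFourTwo) (by
      simp only [Polynomial.coe_mul, Polynomial.coe_pow, Polynomial.coe_add, Polynomial.coe_one,
        Polynomial.coe_X, Polynomial.coe_neg]
      linear_combination hrel)
    have hne : (1 + X : (ZMod 2)[X]) ≠ 0 := by
      rw [add_comm]; exact (monic_X_add_C (1 : ZMod 2)).ne_zero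
    have hv0 : v.map zmodFourTwo = 0 := by simpa [hne] using hzero
    have := congrArg redFourTwo hv
    rw [redFourTwo_coe, hv0, Polynomial.coe_zero, map_mul, map_pow, red_g] at this
    refine (mul_eq_zero.mp this).resolve_left (pow_ne_zero _ fun h0 => hne ?_)
    apply Polynomial.coe_injective
    simpa using h0
  have two := two_eq_zero_of_zmod_two
  have hξ2 := congrArg redFourTwo hξ
  rw [map_mul, map_pow, red_g, map_neg, red_X] at hξ2
  rw [hU] at hU0
  rw [hV] at hV0
  simp only [map_add, map_mul, map_pow, red_g, red_aeval, map_ofNat] at hU0 hV0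
  refine cubic_double_root (ξ := redFourTwo ξ) (g := 1 + PowerSeries.X) ?_ ?_ ?_ hU0 hV0
  · intro h0
    rw [h0, zero_mul] at hξ2
    simp [PowerSeries.X_ne_zero] at hξ2
  · simpa using congrArg PowerSeries.constantCoeff hξ2
  · linear_combination hξ2 - (1 + PowerSeries.X) * two

/-- The substitution `x ↦ -X/(1+X)²` turns the continued fraction with partial numerators
`a k = 1 + 2 β k`, reduced modulo `4`, into `(1 + X)(1 + 2 ∑ β k X ^ k)`. -/
lemma subst_continued_fraction {a β : ℕ → ℤ} (ha : ∀ k, a k = 1 + 2 * β k) (ha0 : a 0 = 1)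
    {P Q : ℕ → ℤ[X]} (hP0 : P 0 = 1) (hP1 : P 1 = 1)
    (hP : ∀ n, P (n + 2) = P (n + 1) + C (a (n + 2)) * X * P n)
    (hQ0 : Q 0 = 1) (hQ1 : Q 1 = 1 + C (a 1) * X)
    (hQ : ∀ n, Q (n + 2) = Q (n + 1) + C (a (n + 2)) * X * Q n)
    {F : PowerSeries ℤ} (hF : ∀ n : ℕ, (PowerSeries.X : PowerSeries ℤ) ^ (n + 1) ∣
      F * (Q n : PowerSeries ℤ) - (P n : PowerSeries ℤ))
    {ξ : PowerSeries (ZMod 4)} (hξ : ξ * (1 + PowerSeries.X) ^ 2 = -PowerSeries.X)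
    (hs : PowerSeries.HasSubst ξ) :
    PowerSeries.substAlgHom (R := ZMod 4) hs (PowerSeries.map (Int.castRingHom (ZMod 4)) F) =
      (1 + PowerSeries.X) * (1 + 2 * PowerSeries.mk fun i => (β i : ZMod 4)) := by
  have four := four_eq_zero_of_zmod_four
  have hXξ : PowerSeries.X ∣ ξ := by
    rw [PowerSeries.X_dvd_iff]
    simpa using congrArg PowerSeries.constantCoeff hξ
  set tail : ℕ → PowerSeries (ZMod 4) := fun k => PowerSeries.mk fun i => (β (k + i) : ZMod 4)
    with htail
  have tail_succ (k : ℕ) : tail k = (β k : PowerSeries (ZMod 4)) + PowerSeries.X * tail (k + 1) := by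
    ext i
    rw [← map_intCast (PowerSeries.C (R := ZMod 4))]
    rcases i with _ | i
    · simp [htail]
    · rw [map_add, PowerSeries.coeff_C, if_neg i.succ_ne_zero, PowerSeries.coeff_succ_X_mul]
      simp [htail, add_assoc, add_comm 1 i]
  set G : ℕ → PowerSeries (ZMod 4) := fun k => (1 + PowerSeries.X) * (1 + 2 * tail k) with hG
  have G_rec (k : ℕ) : G k + ξ * (G k * G (k + 1)) = (a k : PowerSeries (ZMod 4)) := by
    rw [ha k]
    simp only [hG]
    push_cast
    linear_combination (1 + 2 * tail k) * (1 + 2 * tail (k + 1)) * hξ + 2 * tail_succ k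
      - PowerSeries.X * tail k * tail (k + 1) * four
  set ev : ℤ[X] →+* PowerSeries (ZMod 4) := eval₂RingHom (Int.castRingHom _) ξ with hev
  have ev_X : ev X = ξ := by simp [hev]
  have ev_C (n : ℤ) : ev (C n) = n := by simp [hev]
  set Φ : PowerSeries ℤ →+* PowerSeries (ZMod 4) :=
    (PowerSeries.substAlgHom (R := ZMod 4) hs : PowerSeries (ZMod 4) →+* PowerSeries (ZMod 4)).comp
      (PowerSeries.map (Int.castRingHom (ZMod 4))) with hΦ
  have Φ_X : Φ PowerSeries.X = ξ := by
    simp only [hΦ, RingHom.comp_apply, PowerSeries.map_X]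
    exact PowerSeries.substAlgHom_X hs
  have Φ_coe (p : ℤ[X]) : Φ p = ev p := by
    have : Φ.comp coeToPowerSeries.ringHom = ev := by
      refine Polynomial.ringHom_ext' (RingHom.ext_int _ _) ?_
      rw [RingHom.comp_apply, coeToPowerSeries.ringHom_apply, Polynomial.coe_X, Φ_X, ev_X]
    exact RingHom.congr_fun this p
  have hD : ∀ n, G 0 * ev (Q (n + 1)) - ev (P (n + 1)) =
      -ξ * G (n + 2) * (G 0 * ev (Q n) - ev (P n)) := by
    intro n
    induction n with
    | zero =>
      have h0 := G_rec 0
      rw [ha0] at h0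
      simp only [zero_add, hP0, hP1, hQ0, hQ1, map_add, map_mul, map_one, ev_X, ev_C]
      push_cast at h0
      linear_combination (1 + ξ * G 2) * h0 - ξ * G 0 * G_rec 1
    | succ n ih =>
      rw [hP, hQ]
      simp only [map_add, map_mul, ev_X, ev_C]
      linear_combination (1 + ξ * G (n + 3)) * ih - ξ * (G 0 * ev (Q n) - ev (P n)) * G_rec (n + 2)
  have hdvd : ∀ n, PowerSeries.X ^ (n + 1) ∣ G 0 * ev (Q n) - ev (P n) := by
    intro n
    induction n with
    | zero =>
      have h0 := G_rec 0
      rw [ha0] at h0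
      push_cast at h0
      rw [hP0, hQ0, map_one, zero_add, pow_one,
        show G 0 * 1 - 1 = ξ * (-(G 0 * G 1)) by linear_combination h0]
      exact hXξ.mul_right _
    | succ n ih =>
      rw [hD, pow_succ']
      exact mul_dvd_mul ((hXξ.neg_right).mul_right _) ih
  have hconst : ∀ n, PowerSeries.constantCoeff (ev (Q n)) = 1 := by
    have hc := PowerSeries.X_dvd_iff.mp hXξ
    intro n
    induction n using Nat.twoStepInduction with
    | zero => simp [hQ0]
    | one => simp [hQ1, ev_X, hc]
    | more n _ ih => simp [hQ, ev_X, hc, ih]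
  have hzero : Φ F - G 0 = 0 := by
    ext n
    have h1 : PowerSeries.X ^ (n + 1) ∣ Φ F * ev (Q n) - ev (P n) := by
      have := map_dvd Φ (hF n)
      rw [map_pow, map_sub, map_mul, Φ_X, Φ_coe, Φ_coe] at this
      exact (pow_dvd_pow_of_dvd hXξ _).trans this
    have h2 := dvd_sub h1 (hdvd n)
    rw [show Φ F * ev (Q n) - ev (P n) - (G 0 * ev (Q n) - ev (P n)) =
      (Φ F - G 0) * ev (Q n) by ring] at h2
    have hu : IsUnit (ev (Q n)) := by
      rw [PowerSeries.isUnit_iff_constantCoeff, hconst]; exact isUnit_one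
    rw [hu.dvd_mul_right] at h2
    rw [PowerSeries.X_pow_dvd_iff.mp h2 n (Nat.lt_succ_self n), map_zero]
  have := sub_eq_zero.mp hzero
  simpa [hΦ, hG, htail] using this

lemma no_low_degree_annihilator {a β : ℕ → ℤ} (ha : ∀ k, a k = 1 + 2 * β k) (ha0 : a 0 = 1)
    {P Q : ℕ → ℤ[X]} (hP0 : P 0 = 1) (hP1 : P 1 = 1)
    (hP : ∀ n, P (n + 2) = P (n + 1) + C (a (n + 2)) * X * P n)
    (hQ0 : Q 0 = 1) (hQ1 : Q 1 = 1 + C (a 1) * X)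
    (hQ : ∀ n, Q (n + 2) = Q (n + 1) + C (a (n + 2)) * X * Q n)
    {F : PowerSeries ℤ} (hF : ∀ n : ℕ, (PowerSeries.X : PowerSeries ℤ) ^ (n + 1) ∣
      F * (Q n : PowerSeries ℤ) - (P n : PowerSeries ℤ))
    (hβ : ∀ p q : (ZMod 2)[X],
      (q : PowerSeries (ZMod 2)) * (PowerSeries.mk fun i => (β i : ZMod 2)) = p → q = 0)
    {R : Polynomial (Polynomial (ZMod 4))} (hdeg : R.natDegree ≤ 3)
    (hu : IsUnit (HahnSeries.ofPowerSeries ℤ (ZMod 4) (R.leadingCoeff : PowerSeries (ZMod 4))))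
    (hR : Polynomial.eval₂ Polynomial.coeToPowerSeries.ringHom
      (PowerSeries.map (Int.castRingHom (ZMod 4)) F) R = 0) : False := by
  obtain ⟨ξ, hξ⟩ := exists_mul_one_add_X_sq (ZMod 4)
  have hs : PowerSeries.HasSubst ξ := PowerSeries.HasSubst.of_constantCoeff_zero' (by
    simpa using congrArg PowerSeries.constantCoeff hξ)
  set φ : PowerSeries (ZMod 4) →+* PowerSeries (ZMod 4) :=
    (PowerSeries.substAlgHom (R := ZMod 4) hs :
      PowerSeries (ZMod 4) →+* PowerSeries (ZMod 4)) with hφ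
  have φ_coe (p : (ZMod 4)[X]) : φ p = aeval ξ p := PowerSeries.substAlgHom_coe hs p
  have hφF : φ (PowerSeries.map (Int.castRingHom (ZMod 4)) F) =
      (1 + PowerSeries.X) * (1 + 2 * PowerSeries.mk fun i => (β i : ZMod 4)) :=
    subst_continued_fraction ha ha0 hP0 hP1 hP hQ0 hQ1 hQ hF hξ hs
  have hrel := congrArg φ hR
  rw [eval₂_eq_sum_range' _ (Nat.lt_succ_of_le hdeg)] at hrel
  simp only [Finset.sum_range_succ, Finset.sum_range_zero, map_add, map_mul, map_pow, map_zero,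
    zero_add, pow_zero, pow_one, mul_one, coeToPowerSeries.ringHom_apply, φ_coe, hφF] at hrel
  have hB : redFourTwo (PowerSeries.mk fun i => (β i : ZMod 4)) =
      PowerSeries.mk fun i => (β i : ZMod 2) := by
    ext i
    simp [coeff_redFourTwo]
  obtain ⟨h0, h1, h2, h3⟩ := map_eq_zero_of_cubic hξ hrel (by rwa [hB])
  apply redFourTwo_leadingCoeff_ne_zero hu
  rw [leadingCoeff]
  generalize R.natDegree = d at hdeg
  interval_cases d <;> assumption

lemma expand_two_eq_sq (f : PowerSeries (ZMod 2)) :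
    PowerSeries.expand 2 two_ne_zero f = f ^ 2 := by
  have h := MvPowerSeries.map_frobenius_expand (p := 2) two_ne_zero (f := f)
  rw [ZMod.frobenius_zmod, MvPowerSeries.map_id] at h
  exact h

lemma coeff_two_mul_sq (f : PowerSeries (ZMod 2)) (n : ℕ) :
    PowerSeries.coeff (2 * n) (f ^ 2) = PowerSeries.coeff n f := by
  rw [← expand_two_eq_sq, PowerSeries.coeff_expand_mul]

lemma coeff_two_mul_add_one_sq (f : PowerSeries (ZMod 2)) (n : ℕ) :
    PowerSeries.coeff (2 * n + 1) (f ^ 2) = 0 := by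
  rw [← expand_two_eq_sq, PowerSeries.coeff_expand_of_not_dvd]
  omega

/-- The geometric series `∑ X ^ (2 n + 1)`. -/
noncomputable def oddGeom : PowerSeries (ZMod 2) :=
  PowerSeries.mk fun n => if n % 2 = 1 then 1 else 0

lemma one_add_X_sq_mul_oddGeom : (1 + PowerSeries.X) ^ 2 * oddGeom = PowerSeries.X := by
  have : PowerSeries.X ^ 2 * oddGeom + oddGeom = PowerSeries.X := by
    ext n
    rw [map_add, PowerSeries.coeff_X_pow_mul', PowerSeries.coeff_X]
    rcases n with _ | _ | n
    · simp [oddGeom]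
    · simp [oddGeom]
    · have : (n + 1 + 1) % 2 = n % 2 := by omega
      simp only [oddGeom, PowerSeries.coeff_mk, this]
      simpa using CharTwo.add_self_eq_zero (if n % 2 = 1 then (1 : ZMod 2) else 0)
  linear_combination this + PowerSeries.X * oddGeom * two_eq_zero_of_zmod_two

/-- A solution of `B = e B² + X/(1+X)²` with `e` of degree one is irrational. -/
lemma irrational_of_quadratic {B : PowerSeries (ZMod 2)} {e : (ZMod 2)[X]} (he : e.natDegree = 1)
    (hB : B = e * B ^ 2 + oddGeom) (p q : (ZMod 2)[X])
    (h : (q : PowerSeries (ZMod 2)) * B = p) : q = 0 := by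
  have two := two_eq_zero_of_zmod_two
  have hdeg : (1 + X : (ZMod 2)[X]).natDegree = 1 := by
    rw [add_comm]; exact natDegree_X_add_C 1
  refine eq_zero_of_quadratic_relation (p := (1 + X) * p) he hdeg natDegree_X ?_
  apply Polynomial.coe_injective
  simp only [Polynomial.coe_mul, Polynomial.coe_pow, Polynomial.coe_add, Polynomial.coe_one,
    Polynomial.coe_X, Polynomial.coe_zero, ← h]
  linear_combination -((1 + PowerSeries.X) ^ 2 * (q : PowerSeries (ZMod 2)) ^ 2) * hB
    - (q : PowerSeries (ZMod 2)) ^ 2 * one_add_X_sq_mul_oddGeom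
    + ((1 + PowerSeries.X) ^ 2 * (q : PowerSeries (ZMod 2)) ^ 2 * B) * two

lemma tmSeq_zero : tmSeq 0 = 1 := by rw [tmSeq]

lemma pdSeq_zero : pdSeq 0 = 1 := by rw [pdSeq]

lemma tmSeq_two_mul (n : ℕ) : tmSeq (2 * n) = tmSeq n := by
  rcases n with _ | n
  · rfl
  · rw [show 2 * (n + 1) = (2 * n + 1) + 1 by ring, tmSeq, if_pos (by omega)]
    congr 1
    omega

lemma tmSeq_two_mul_add_one (n : ℕ) : tmSeq (2 * n + 1) = -tmSeq n := by
  rw [tmSeq, if_neg (by omega)]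
  congr 2
  omega

lemma pdSeq_two_mul (n : ℕ) : pdSeq (2 * n) = 1 := by
  rcases n with _ | n
  · exact pdSeq_zero
  · rw [show 2 * (n + 1) = (2 * n + 1) + 1 by ring, pdSeq, if_pos (by omega)]

lemma pdSeq_two_mul_add_one (n : ℕ) : pdSeq (2 * n + 1) = -pdSeq n := by
  rw [pdSeq, if_neg (by omega)]
  congr 2
  omega

lemma tmSeq_odd (n : ℕ) : Odd (tmSeq n) := by
  induction n using Nat.strong_induction_on with
  | _ n ih =>
    rcases Nat.even_or_odd' n with ⟨k, rfl | rfl⟩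
    · rcases Nat.eq_zero_or_pos k with rfl | hk
      · rw [mul_zero, tmSeq_zero]; exact odd_one
      · rw [tmSeq_two_mul]; exact ih k (by omega)
    · rw [tmSeq_two_mul_add_one]; exact (ih k (by omega)).neg

lemma pdSeq_odd (n : ℕ) : Odd (pdSeq n) := by
  induction n using Nat.strong_induction_on with
  | _ n ih =>
    rcases Nat.even_or_odd' n with ⟨k, rfl | rfl⟩
    · rw [pdSeq_two_mul]; exact odd_one
    · rw [pdSeq_two_mul_add_one]; exact (ih k (by omega)).neg

lemma eq_one_add_two_mul_half {x : ℤ} (h : Odd x) : x = 1 + 2 * ((x - 1) / 2) := by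
  obtain ⟨k, rfl⟩ := h
  omega

lemma half_neg {x : ℤ} (h : Odd x) : (-x - 1) / 2 = -1 - (x - 1) / 2 := by
  obtain ⟨k, rfl⟩ := h
  omega

lemma tm_quadratic :
    (PowerSeries.mk fun i => (((tmSeq i - 1) / 2 : ℤ) : ZMod 2)) =
      ((1 + X : (ZMod 2)[X]) : PowerSeries (ZMod 2)) *
        (PowerSeries.mk fun i => (((tmSeq i - 1) / 2 : ℤ) : ZMod 2)) ^ 2 + oddGeom := by
  simp only [Polynomial.coe_add, Polynomial.coe_one, Polynomial.coe_X, add_mul, one_mul]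
  ext n
  simp only [map_add]
  rcases Nat.even_or_odd' n with ⟨k, rfl | rfl⟩
  · rw [coeff_two_mul_sq]
    rcases k with _ | k
    · simp [oddGeom]
    · rw [show 2 * (k + 1) = 2 * k + 1 + 1 by ring, PowerSeries.coeff_succ_X_mul,
        coeff_two_mul_add_one_sq, show 2 * k + 1 + 1 = 2 * (k + 1) by ring]
      simp [oddGeom, tmSeq_two_mul]
  · rw [coeff_two_mul_add_one_sq, PowerSeries.coeff_succ_X_mul, coeff_two_mul_sq]
    simp only [PowerSeries.coeff_mk, oddGeom, tmSeq_two_mul_add_one, half_neg (tmSeq_odd k)]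
    rw [if_pos (by omega)]
    push_cast
    generalize (((tmSeq k - 1) / 2 : ℤ) : ZMod 2) = x
    revert x
    decide

lemma pd_quadratic :
    (PowerSeries.mk fun i => (((pdSeq i - 1) / 2 : ℤ) : ZMod 2)) =
      ((X : (ZMod 2)[X]) : PowerSeries (ZMod 2)) *
        (PowerSeries.mk fun i => (((pdSeq i - 1) / 2 : ℤ) : ZMod 2)) ^ 2 + oddGeom := by
  rw [Polynomial.coe_X]
  ext n
  simp only [map_add]
  rcases Nat.even_or_odd' n with ⟨k, rfl | rfl⟩
  · rcases k with _ | k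
    · simp [oddGeom, pdSeq]
    · rw [show 2 * (k + 1) = 2 * k + 1 + 1 by ring, PowerSeries.coeff_succ_X_mul,
        coeff_two_mul_add_one_sq, show 2 * k + 1 + 1 = 2 * (k + 1) by ring]
      simp [oddGeom, pdSeq_two_mul]
  · rw [PowerSeries.coeff_succ_X_mul, coeff_two_mul_sq]
    simp only [PowerSeries.coeff_mk, oddGeom, pdSeq_two_mul_add_one, half_neg (pdSeq_odd k)]
    rw [if_pos (by omega)]
    push_cast
    generalize (((pdSeq k - 1) / 2 : ℤ) : ZMod 2) = x
    revert x
    decide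

/-- No polynomial R(x,y) ∈ (ℤ/4ℤ)[x][y] of degree at most 3 in y, with nonzero leading
coefficient that is a unit in the Laurent series ring (ℤ/4ℤ)((x)), annihilates the
reduction mod 4 of C(x) or of D(x). -/
theorem tm_pd_cf_no_low_degree_annihilator (Cx Dx : PowerSeries ℤ)
    (hC : ∀ n : ℕ, (PowerSeries.X : PowerSeries ℤ) ^ (n + 1) ∣
      Cx * (Qtm n : PowerSeries ℤ) - (Ptm n : PowerSeries ℤ))
    (hD : ∀ n : ℕ, (PowerSeries.X : PowerSeries ℤ) ^ (n + 1) ∣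
      Dx * (Qpd n : PowerSeries ℤ) - (Ppd n : PowerSeries ℤ)) :
    ¬ ∃ R : Polynomial (Polynomial (ZMod 4)),
      R ≠ 0 ∧ R.natDegree ≤ 3 ∧
      IsUnit ((HahnSeries.ofPowerSeries ℤ (ZMod 4))
        (R.leadingCoeff : PowerSeries (ZMod 4))) ∧
      (Polynomial.eval₂ Polynomial.coeToPowerSeries.ringHom
          (PowerSeries.map (Int.castRingHom (ZMod 4)) Cx) R = 0 ∨
        Polynomial.eval₂ Polynomial.coeToPowerSeries.ringHom
          (PowerSeries.map (Int.castRingHom (ZMod 4)) Dx) R = 0) := by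
  rintro ⟨R, -, hdeg, hu, hR | hR⟩
  · refine no_low_degree_annihilator (a := tmSeq) (β := fun k => (tmSeq k - 1) / 2)
      (fun k => eq_one_add_two_mul_half (tmSeq_odd k)) tmSeq_zero rfl rfl (fun _ => rfl) rfl ?_
      (fun _ => rfl) hC (irrational_of_quadratic ?_ tm_quadratic) hdeg hu hR
    · have : tmSeq 1 = -1 := by simpa [tmSeq_zero] using tmSeq_two_mul_add_one 0
      simp [Qtm, this, sub_eq_add_neg]
    · rw [add_comm]; exact natDegree_X_add_C 1
  · refine no_low_degree_annihilator (a := pdSeq) (β := fun k => (pdSeq k - 1) / 2)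
      (fun k => eq_one_add_two_mul_half (pdSeq_odd k)) pdSeq_zero rfl rfl (fun _ => rfl) rfl ?_
      (fun _ => rfl) hD (irrational_of_quadratic natDegree_X pd_quadratic) hdeg hu hR
    have : pdSeq 1 = -1 := by simpa [pdSeq_zero] using pdSeq_two_mul_add_one 0
    simp [Qpd, this, sub_eq_add_neg]
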